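/- Let n ≥ 3, let 1 ≤ i < j ≤ n, and let 0 ≤ k ≤ n. Then the number of permutations of {1,…,n} with exactly k fixed points in which j lies in a cycle of length at least 3 and i precedes j satisfies 2(n−1)(n−2)·#{σ ∈ D_{n,k} : σ(j) ≠ j, σ(σ(j)) ≠ j, and σ⁻¹(i) < σ⁻¹(j)} = d_{n−1,k}·(n−k−1)·(2k(n−i−1) + 2(i−1+n−j) + (n−2)(n−3−k)). -/

import Mathlib

/-- Number of inversions of a permutation of `Fin n`: the number of pairs of
positions `a < b` with `σ a > σ b`. -/
def inversions {n : ℕ} (σ : Equiv.Perm (Fin n)) : ℕ :=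
  ((Finset.univ : Finset (Fin n × Fin n)).filter
    (fun p => p.1 < p.2 ∧ σ p.2 < σ p.1)).card

/-- The set of derangements (fixed-point-free permutations) of `Fin n`. -/
def derangeSet (n : ℕ) : Finset (Equiv.Perm (Fin n)) :=
  Finset.univ.filter (fun σ => ∀ x, σ x ≠ x)

/-- The number of derangements of `Fin n` (so `numDerange 0 = 1`). -/
def numDerange (n : ℕ) : ℕ := (derangeSet n).card

/-- The number of fixed points of a permutation of `Fin n`. -/
def fixedPointCount {n : ℕ} (σ : Equiv.Perm (Fin n)) : ℕ :=
  (Finset.univ.filter (fun x => σ x = x)).card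

/-- The set of permutations of `Fin n` with exactly `k` fixed points. -/
def permsWithFixed (n k : ℕ) : Finset (Equiv.Perm (Fin n)) :=
  Finset.univ.filter (fun σ => fixedPointCount σ = k)

/-- The number of permutations of `Fin n` with exactly `k` fixed points. -/
def numPermsWithFixed (n k : ℕ) : ℕ := (permsWithFixed n k).card

/-- The permutations of `Fin n` that fix `j` and have exactly `k` other fixed points. -/
def permsFixing {n : ℕ} (k : ℕ) (j : Fin n) : Finset (Equiv.Perm (Fin n)) :=
  Finset.univ.filter fun τ => τ j = j ∧ fixedPointCount τ = k + 1

/-- The number of permutations in `permsFixing k j` that send `a` to `i` and move `b`. -/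
def sendMoveCount {n : ℕ} (k : ℕ) (i j a b : Fin n) : ℕ :=
  ((permsFixing k j).filter fun τ => τ a = i ∧ τ b ≠ b).card

section
open Finset Equiv

theorem fixedPointCount_conj {n : ℕ} (τ π : Perm (Fin n)) :
    fixedPointCount (π * τ * π⁻¹) = fixedPointCount τ := by
  unfold fixedPointCount
  refine (card_bij (fun x _ => π x) ?_ ?_ ?_).symm
  · intro x hx
    rw [mem_filter_univ] at hx ⊢
    simpa using hx
  · intro x _ y _ h
    exact π.injective h
  · intro y hy
    refine ⟨π⁻¹ y, ?_, by simp⟩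
    rw [mem_filter_univ, Perm.mul_apply, Perm.mul_apply] at hy
    rw [mem_filter_univ, Perm.eq_inv_iff_eq, hy]

theorem mem_permsFixing {n k : ℕ} {j : Fin n} {τ : Perm (Fin n)} :
    τ ∈ permsFixing k j ↔ τ j = j ∧ fixedPointCount τ = k + 1 :=
  mem_filter_univ τ

theorem conj_mem_permsFixing {n k : ℕ} {j : Fin n} {τ π : Perm (Fin n)} (hπ : π j = j)
    (hτ : τ ∈ permsFixing k j) : π * τ * π⁻¹ ∈ permsFixing k j := by
  rw [mem_permsFixing] at hτ ⊢
  have h : π⁻¹ j = j := by rw [Perm.inv_eq_iff_eq, hπ]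
  refine ⟨by rw [Perm.mul_apply, Perm.mul_apply, h, hτ.1, hπ], by rw [fixedPointCount_conj, hτ.2]⟩

theorem card_filter_permsFixing_conj {n k : ℕ} {j : Fin n} {π : Perm (Fin n)} (hπ : π j = j)
    (p q : Perm (Fin n) → Prop) [DecidablePred p] [DecidablePred q]
    (h : ∀ τ, q (π * τ * π⁻¹) ↔ p τ) :
    ((permsFixing k j).filter p).card = ((permsFixing k j).filter q).card := by
  refine card_bij (fun τ _ => π * τ * π⁻¹) ?_ ?_ ?_
  · intro τ hτ
    rw [mem_filter] at hτ ⊢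
    exact ⟨conj_mem_permsFixing hπ hτ.1, (h τ).2 hτ.2⟩
  · intro τ _ ρ _ e
    simpa using e
  · intro τ hτ
    rw [mem_filter] at hτ
    have h' : π⁻¹ j = j := by rw [Perm.inv_eq_iff_eq, hπ]
    have e : π * (π⁻¹ * τ * π) * π⁻¹ = τ := by group
    refine ⟨π⁻¹ * τ * π, ?_, e⟩
    rw [mem_filter, ← h, e]
    exact ⟨by simpa using conj_mem_permsFixing h' hτ.1, hτ.2⟩

theorem sendMoveCount_conj {n k : ℕ} {i j : Fin n} {π : Perm (Fin n)} (hi : π i = i)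
    (hj : π j = j) (a b : Fin n) :
    sendMoveCount k i j a b = sendMoveCount k i j (π a) (π b) := by
  refine card_filter_permsFixing_conj hj _ _ fun τ => ?_
  have : π (τ a) = i ↔ τ a = i := by
    conv_lhs => rw [← hi]
    exact π.injective.eq_iff
  simp [this]

theorem card_moved_of_mem_permsFixing {n k : ℕ} {j : Fin n} {τ : Perm (Fin n)}
    (hτ : τ ∈ permsFixing k j) : ((univ.filter fun b => τ b ≠ b).card : ℤ) = n - k - 1 := by
  have h := card_filter_add_card_filter_not (s := (univ : Finset (Fin n))) (fun b => τ b = b)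
  rw [mem_permsFixing, fixedPointCount] at hτ
  rw [hτ.2, card_univ, Fintype.card_fin] at h
  simp only [ne_eq]
  omega

theorem sum_sendMoveCount {n k : ℕ} (i j a : Fin n) :
    ∑ b, (sendMoveCount k i j a b : ℤ) =
      ((permsFixing k j).filter fun τ => τ a = i).card * ((n : ℤ) - k - 1) := by
  have h : ∀ b, (sendMoveCount k i j a b : ℤ) =
      ∑ τ ∈ (permsFixing k j).filter (fun τ => τ a = i), if τ b ≠ b then 1 else 0 := by
    intro b
    rw [sendMoveCount, ← filter_filter, card_filter]
    push_cast
    rfl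
  simp_rw [h]
  rw [sum_comm, ← nsmul_eq_mul, ← sum_const]
  refine sum_congr rfl fun τ hτ => ?_
  rw [← card_moved_of_mem_permsFixing (mem_filter.1 hτ).1, card_filter]
  push_cast
  rfl

/-- The permutations in `permsFixing k j` that fix `i` make up a fraction `k / (n - 1)`. -/
theorem card_permsFixing_filter_fixed {n k : ℕ} {i j : Fin n} (hij : i ≠ j) :
    ((n : ℤ) - 1) * ((permsFixing k j).filter fun τ => τ i = i).card =
      k * (permsFixing k j).card := by
  have h1 : ∀ x ∈ univ.erase j, (((permsFixing k j).filter fun τ => τ x = x).card : ℤ) =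
      ((permsFixing k j).filter fun τ => τ i = i).card := by
    intro x hx
    have hx : x ≠ j := by simpa using hx
    congr 1
    refine card_filter_permsFixing_conj (π := swap i x) (swap_apply_of_ne_of_ne hij.symm hx.symm)
      _ _ fun τ => ?_
    simp only [Perm.mul_apply, swap_inv, swap_apply_left]
    rw [swap_apply_eq_iff, swap_apply_left]
  have h2 : ∑ x ∈ univ.erase j, (((permsFixing k j).filter fun τ => τ x = x).card : ℤ) =
      ∑ τ ∈ permsFixing k j, (k : ℤ) := by
    simp_rw [card_filter]
    push_cast
    rw [sum_comm]
    refine sum_congr rfl fun τ hτ => ?_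
    rw [mem_permsFixing, fixedPointCount, card_filter] at hτ
    have := add_sum_erase univ (fun x => if τ x = x then 1 else 0) (mem_univ j)
    rw [hτ.2, if_pos hτ.1] at this
    have : ∑ x ∈ univ.erase j, (if τ x = x then 1 else 0) = k := by omega
    exact_mod_cast this
  rw [sum_congr rfl h1, sum_const, sum_const, card_erase_of_mem (mem_univ j), card_univ,
    Fintype.card_fin, nsmul_eq_mul, nsmul_eq_mul, Nat.cast_sub (by have := j.pos; omega)] at h2
  push_cast at h2
  linarith

theorem sum_card_permsFixing_send {n k : ℕ} (i j : Fin n) :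
    ∑ a, (((permsFixing k j).filter fun τ => τ a = i).card : ℤ) = (permsFixing k j).card := by
  simp_rw [card_filter]
  push_cast
  rw [sum_comm, card_eq_sum_ones]
  push_cast
  refine sum_congr rfl fun τ _ => ?_
  simp_rw [← Perm.eq_inv_iff_eq]
  simp

theorem permsFixing_send_self {n k : ℕ} {i j : Fin n} (hij : i ≠ j) :
    ((permsFixing k j).filter fun τ => τ j = i) = ∅ := by
  refine filter_eq_empty_iff.2 fun τ hτ h => ?_
  rw [mem_permsFixing] at hτ
  exact hij (h.symm.trans hτ.1)

theorem sendMoveCount_fixed_source {n k : ℕ} {i j : Fin n} (hij : i ≠ j) (b : Fin n) :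
    sendMoveCount k i j j b = 0 := by
  rw [sendMoveCount, ← filter_filter, permsFixing_send_self hij]
  rfl

theorem sendMoveCount_fixed_right {n k : ℕ} (i j a : Fin n) : sendMoveCount k i j a j = 0 := by
  refine card_eq_zero.2 (filter_eq_empty_iff.2 fun τ hτ h => ?_)
  rw [mem_permsFixing] at hτ
  exact h.2 hτ.1

theorem sendMoveCount_self {n k : ℕ} (i j : Fin n) : sendMoveCount k i j i i = 0 :=
  card_eq_zero.2 (filter_eq_empty_iff.2 fun _ _ h => h.2 h.1)

theorem sendMoveCount_target {n k : ℕ} {i a : Fin n} (j : Fin n) (ha : a ≠ i) :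
    sendMoveCount k i j a i = ((permsFixing k j).filter fun τ => τ a = i).card := by
  refine congrArg card (filter_congr fun τ _ => and_iff_left_of_imp fun h h' => ha ?_)
  exact τ.injective (h.trans h'.symm)

theorem sendMoveCount_source {n k : ℕ} {i a : Fin n} (j : Fin n) (ha : a ≠ i) :
    sendMoveCount k i j a a = ((permsFixing k j).filter fun τ => τ a = i).card := by
  refine congrArg card (filter_congr fun τ _ => and_iff_left_of_imp fun h h' => ha ?_)
  exact h'.symm.trans h

theorem fixedPointCount_mul_swap {n : ℕ} {τ : Perm (Fin n)} {j b : Fin n} (hj : τ j = j)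
    (hb : τ b ≠ b) : fixedPointCount τ = fixedPointCount (τ * swap b j) + 1 := by
  have hbj : b ≠ j := fun h => hb (by rw [h, hj])
  have e : (univ.filter fun x => τ x = x) =
      insert j (univ.filter fun x => (τ * swap b j) x = x) := by
    ext x
    rw [mem_filter_univ, mem_insert, mem_filter_univ, Perm.mul_apply]
    by_cases hx : x = j
    · simp [hx, hj]
    by_cases hx' : x = b
    · subst hx'
      simp [hbj, hb, hj, Ne.symm hbj]
    · rw [swap_apply_of_ne_of_ne hx' hx]
      simp [hx]
  rw [fixedPointCount, e, card_insert_of_notMem]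
  · rfl
  · rw [mem_filter_univ, Perm.mul_apply, swap_apply_right]
    intro h
    exact hbj (τ.injective (h.trans hj.symm))

/-- Removing `j` from its cycle, which has length at least three, and recording the position
of `j`. -/
theorem card_filter_eq_sum_sendMoveCount {n k : ℕ} (i j : Fin n) :
    ((permsWithFixed n k).filter
      (fun σ => σ j ≠ j ∧ σ (σ j) ≠ j ∧ σ⁻¹ i < σ⁻¹ j)).card =
      ∑ b, ∑ a, if swap b j a < b then sendMoveCount k i j a b else 0 := by
  have h1 : ((permsWithFixed n k).filter
      (fun σ => σ j ≠ j ∧ σ (σ j) ≠ j ∧ σ⁻¹ i < σ⁻¹ j)).card =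
      (((univ : Finset (Fin n)) ×ˢ permsFixing k j).filter
        (fun p => p.2 p.1 ≠ p.1 ∧ swap p.1 j (p.2⁻¹ i) < p.1)).card := by
    refine card_nbij' (fun σ => (σ⁻¹ j, σ * swap (σ⁻¹ j) j)) (fun p => p.2 * swap p.1 j)
      ?_ ?_ ?_ ?_
    · intro σ hσ
      simp only [permsWithFixed, coe_filter, mem_filter, mem_univ, true_and, Set.mem_ofPred_eq] at hσ
      obtain ⟨hk, hj, hj2, hlt⟩ := hσ
      have h2 : (σ * swap (σ⁻¹ j) j) j = j := by simp
      have h3 : (σ * swap (σ⁻¹ j) j) (σ⁻¹ j) ≠ σ⁻¹ j := by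
        simp only [Perm.mul_apply, swap_apply_left]
        rwa [ne_eq, Perm.eq_inv_iff_eq]
      have h4 := fixedPointCount_mul_swap h2 h3
      rw [mul_assoc, swap_mul_self, mul_one, hk] at h4
      simp only [mem_permsFixing, coe_filter, mem_product, mem_univ, true_and,
        Set.mem_ofPred_eq]
      refine ⟨⟨h2, h4⟩, h3, ?_⟩
      simpa [mul_inv_rev] using hlt
    · rintro ⟨b, τ⟩ hp
      simp only [mem_permsFixing, coe_filter, mem_product, mem_univ, true_and,
        Set.mem_ofPred_eq] at hp
      obtain ⟨⟨hj, hk⟩, hb, hlt⟩ := hp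
      have hbj : b ≠ j := fun h => hb (by rw [h, hj])
      have h4 := fixedPointCount_mul_swap hj hb
      have hτj : (τ * swap b j)⁻¹ j = b := by
        rw [Perm.inv_eq_iff_eq, Perm.mul_apply, swap_apply_left, hj]
      have hτb : τ b ≠ j := fun h => hbj (τ.injective (h.trans hj.symm))
      simp only [permsWithFixed, coe_filter, mem_filter, mem_univ, true_and, Set.mem_ofPred_eq]
      refine ⟨by omega, by simpa using hτb, ?_, ?_⟩
      · simp only [Perm.mul_apply, swap_apply_right]
        rw [swap_apply_of_ne_of_ne hb hτb]
        exact fun h => hτb (τ.injective (h.trans hj.symm))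
      · rw [hτj]
        simpa [mul_inv_rev] using hlt
    · intro σ _
      simp [mul_assoc]
    · rintro ⟨b, τ⟩ hp
      simp only [mem_permsFixing, coe_filter, mem_product, mem_univ, true_and,
        Set.mem_ofPred_eq] at hp
      have hτj : (τ * swap b j)⁻¹ j = b := by
        rw [Perm.inv_eq_iff_eq, Perm.mul_apply, swap_apply_left, hp.1.1]
      dsimp only
      rw [hτj, mul_assoc, swap_mul_self, mul_one]
  rw [h1, card_filter, sum_product]
  refine sum_congr rfl fun b _ => ?_
  have h5 : ∀ a, (if swap b j a < b then sendMoveCount k i j a b else 0) =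
      ∑ τ ∈ permsFixing k j, if (τ a = i ∧ τ b ≠ b) ∧ swap b j a < b then 1 else 0 := by
    intro a
    split_ifs with h
    · simp only [h, and_true, sendMoveCount]
      rw [card_filter]
    · simp [h]
  simp_rw [h5]
  rw [sum_comm]
  refine sum_congr rfl fun τ _ => ?_
  rw [sum_eq_single (τ⁻¹ i)]
  · simp
  · intro a _ ha
    rw [if_neg]
    rintro ⟨⟨h, _⟩, _⟩
    exact ha (by rw [Perm.eq_inv_iff_eq, h])
  · simp

theorem card_permsFixing {m k : ℕ} (j : Fin (m + 1)) :
    (permsFixing k j).card = numPermsWithFixed m k := by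
  have key : ∀ ρ : Perm (Fin m),
      fixedPointCount (ρ.extendDomain (finSuccAboveEquiv j)) = fixedPointCount ρ + 1 := by
    intro ρ
    have e : (univ.filter fun x => ρ.extendDomain (finSuccAboveEquiv j) x = x) =
        insert j ((univ.filter fun x => ρ x = x).map (Fin.succAboveEmb j)) := by
      ext x
      rcases Fin.eq_self_or_eq_succAbove j x with rfl | ⟨y, rfl⟩
      · simp [Perm.extendDomain_apply_not_subtype]
      · have := Perm.extendDomain_apply_image ρ (finSuccAboveEquiv j) y
        simp only [finSuccAboveEquiv_apply] at this
        simp [this, Fin.succAbove_ne]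
    rw [fixedPointCount, e, card_insert_of_notMem, card_map]
    · rfl
    · simp [Fin.succAbove_ne]
  unfold numPermsWithFixed
  refine (card_bij (fun ρ _ => ρ.extendDomain (finSuccAboveEquiv j)) ?_ ?_ ?_).symm
  · intro ρ hρ
    rw [permsWithFixed, mem_filter_univ] at hρ
    rw [mem_permsFixing]
    exact ⟨Perm.extendDomain_apply_not_subtype _ _ (by simp), by rw [key, hρ]⟩
  · intro ρ _ ρ' _ h
    exact Perm.extendDomainHom_injective (finSuccAboveEquiv j) h
  · intro τ hτ
    rw [mem_permsFixing] at hτ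
    have hne : ∀ x, τ x ≠ j ↔ x ≠ j := fun x => by
      conv_lhs => rw [← hτ.1]
      exact τ.injective.ne_iff
    set ρ : Perm (Fin m) := (finSuccAboveEquiv j).symm.permCongr (τ.subtypePerm hne) with hρ
    have e : ρ.extendDomain (finSuccAboveEquiv j) = τ := by
      ext x
      by_cases hx : x = j
      · subst hx
        rw [Perm.extendDomain_apply_not_subtype ρ (finSuccAboveEquiv x) (fun h => h rfl), hτ.1]
      · rw [Perm.extendDomain_apply_subtype ρ (finSuccAboveEquiv j) hx]
        simp [hρ, permCongr_apply]
    refine ⟨ρ, ?_, e⟩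
    have := key ρ
    rw [e] at this
    rw [permsWithFixed, mem_filter_univ]
    omega

theorem sum_univ_eq_add_add {n : ℕ} {i j : Fin n} (hij : i ≠ j) (f : Fin n → ℤ) :
    ∑ x, f x = f i + f j + ∑ x ∈ univ \ {i, j}, f x := by
  rw [← sum_sdiff (subset_univ {i, j}), sum_pair hij]
  ring

/-- Summation over `a < b` of a symmetric function is half the off-diagonal sum. -/
theorem two_mul_sum_lt_eq {n : ℕ} (s : Finset (Fin n)) (f : Fin n → Fin n → ℤ)
    (hf : ∀ a ∈ s, ∀ b ∈ s, f a b = f b a) :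
    2 * ∑ b ∈ s, ∑ a ∈ s, (if a < b then f a b else 0) =
      ∑ a ∈ s, ((∑ b ∈ s, f a b) - f a a) := by
  have h1 : ∑ b ∈ s, ∑ a ∈ s, (if a < b then f a b else 0) =
      ∑ a ∈ s, ∑ b ∈ s, (if b < a then f a b else 0) :=
    sum_congr rfl fun b hb => sum_congr rfl fun a ha => by rw [hf a ha b hb]
  rw [two_mul]
  nth_rewrite 1 [sum_comm]
  rw [h1, ← sum_add_distrib]
  refine sum_congr rfl fun a ha => ?_
  rw [← sum_add_distrib, eq_sub_iff_add_eq]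
  have h2 : ∑ b ∈ s, (if b = a then f a b else 0) = f a a := by simp [ha]
  rw [← h2, ← sum_add_distrib]
  refine sum_congr rfl fun b _ => ?_
  rcases lt_trichotomy a b with h | h | h
  · simp [h, h.not_gt, h.ne']
  · simp [h]
  · simp [h, h.not_gt, h.ne]

theorem sum_sum_swap_lt_eq {n : ℕ} {i j : Fin n} (hij : i < j) (f : Fin n → Fin n → ℤ) (A B : ℤ)
    (hj : ∀ b, f j b = 0) (hj' : ∀ a, f a j = 0) (hi : f i i = 0)
    (hA : ∀ b ∈ univ \ {i, j}, f i b = A) (hB : ∀ a ∈ univ \ {i, j}, f a i = B)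
    (hB' : ∀ a ∈ univ \ {i, j}, f a a = B) :
    ∑ b, ∑ a, (if swap b j a < b then f a b else 0) =
      (n - i - 2) * A + (i + (n - 1 - j)) * B +
        ∑ b ∈ univ \ {i, j}, ∑ a ∈ univ \ {i, j}, (if a < b then f a b else 0) := by
  have hne := hij.ne
  have c1 : (((univ \ {i, j}).filter fun b => i < b).card : ℤ) = n - i - 2 := by
    have e : ((univ \ {i, j}).filter fun b => i < b) = (Ioi i).erase j := by
      ext x
      simp only [mem_filter, mem_sdiff, mem_univ, true_and, mem_insert, mem_singleton,
        mem_erase, mem_Ioi]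
      grind
    rw [e, card_erase_of_mem (by simpa using hij), Fin.card_Ioi]
    omega
  have c2 : (((univ \ {i, j}).filter fun a => a < i).card : ℤ) = i := by
    have e : ((univ \ {i, j}).filter fun b => b < i) = Iio i := by
      ext x
      simp only [mem_filter, mem_sdiff, mem_univ, true_and, mem_insert, mem_singleton, mem_Iio]
      grind
    rw [e, Fin.card_Iio]
  have c3 : (((univ \ {i, j}).filter fun a => j < a).card : ℤ) = n - 1 - j := by
    have e : ((univ \ {i, j}).filter fun b => j < b) = Ioi j := by
      ext x
      simp only [mem_filter, mem_sdiff, mem_univ, true_and, mem_insert, mem_singleton, mem_Ioi]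
      grind
    rw [e, Fin.card_Ioi]
    omega
  have hbj : ∑ a, (if swap j j a < j then f a j else 0) = 0 :=
    sum_eq_zero fun a _ => by simp [hj']
  have hbi : ∑ a, (if swap i j a < i then f a i else 0) = i * B := by
    rw [sum_univ_eq_add_add hne, hi, hj, ← c2, ← nsmul_eq_mul, ← sum_const, sum_filter]
    simp only [ite_self, zero_add]
    refine sum_congr rfl fun a ha => ?_
    rw [hB a ha]
    simp only [mem_sdiff, mem_univ, true_and, mem_insert, mem_singleton, not_or] at ha
    rw [swap_apply_of_ne_of_ne ha.1 ha.2]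
  have hb : ∀ b ∈ univ \ {i, j}, ∑ a, (if swap b j a < b then f a b else 0) =
      (if i < b then A else 0) + (if j < b then B else 0) +
        ∑ a ∈ univ \ {i, j}, (if a < b then f a b else 0) := by
    intro b hb
    have hb' := hb
    simp only [mem_sdiff, mem_univ, true_and, mem_insert, mem_singleton, not_or] at hb'
    rw [sum_univ_eq_add_add hne, hj, hA b hb, swap_apply_of_ne_of_ne (Ne.symm hb'.1) hne]
    simp only [ite_self, add_zero, add_assoc]
    congr 1
    rw [← add_sum_erase _ _ hb, ← add_sum_erase (univ \ {i, j}) (fun a => if a < b then _ else _) hb,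
      swap_apply_left, hB' b hb]
    simp only [lt_irrefl, if_false, zero_add]
    congr 1
    refine sum_congr rfl fun a ha => ?_
    simp only [mem_erase, mem_sdiff, mem_univ, true_and, mem_insert, mem_singleton, not_or] at ha
    rw [swap_apply_of_ne_of_ne ha.1 ha.2.2]
  rw [sum_univ_eq_add_add hne, hbi, hbj, sum_congr rfl hb, sum_add_distrib, sum_add_distrib,
    ← sum_filter, ← sum_filter, sum_const, sum_const, nsmul_eq_mul, nsmul_eq_mul, c1, c3]
  ring

theorem card_longCycle_precedes {n k : ℕ} (hn : 3 ≤ n) {i j : Fin n} (hij : i < j) :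
    2 * ((n : ℤ) - 1) * ((n : ℤ) - 2) * (((permsWithFixed n k).filter
      (fun σ => σ j ≠ j ∧ σ (σ j) ≠ j ∧ σ⁻¹ i < σ⁻¹ j)).card : ℤ) =
      (permsFixing k j).card * ((n : ℤ) - k - 1) *
        (2 * k * ((n : ℤ) - i - 2) + 2 * (i + (n : ℤ) - 1 - j) +
          ((n : ℤ) - 2) * ((n : ℤ) - 3 - k)) := by
  have hne := hij.ne
  have cU : ((univ \ {i, j} : Finset (Fin n)).card : ℤ) = n - 2 := by
    rw [card_sdiff_of_subset (subset_univ _), card_pair hne, card_univ, Fintype.card_fin]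
    omega
  obtain ⟨c, hc⟩ : (univ \ {i, j} : Finset (Fin n)).Nonempty := by
    rw [← card_pos]
    omega
  set F : ℤ := (((permsFixing k j).filter fun τ => τ i = i).card : ℤ) with hF
  set A : ℤ := (sendMoveCount k i j i c : ℤ) with hA
  set B : ℤ := (((permsFixing k j).filter fun τ => τ c = i).card : ℤ) with hB
  have mU : ∀ a, a ∈ univ \ {i, j} ↔ a ≠ i ∧ a ≠ j := by simp
  rw [mU] at hc
  have sendA : ∀ b ∈ univ \ {i, j}, (sendMoveCount k i j i b : ℤ) = A := by
    intro b hb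
    rw [mU] at hb
    rw [hA, sendMoveCount_conj (π := swap c b)
      (swap_apply_of_ne_of_ne hc.1.symm hb.1.symm)
      (swap_apply_of_ne_of_ne hc.2.symm hb.2.symm) i c, swap_apply_left,
      swap_apply_of_ne_of_ne hc.1.symm hb.1.symm]
  have sendB : ∀ a ∈ univ \ {i, j},
      (((permsFixing k j).filter fun τ => τ a = i).card : ℤ) = B := by
    intro a ha
    rw [mU] at ha
    rw [hB, ← sendMoveCount_target j ha.1, ← sendMoveCount_target j hc.1,
      sendMoveCount_conj (π := swap c a)
      (swap_apply_of_ne_of_ne hc.1.symm ha.1.symm)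
      (swap_apply_of_ne_of_ne hc.2.symm ha.2.symm) c i, swap_apply_left,
      swap_apply_of_ne_of_ne hc.1.symm ha.1.symm]
  have targetB : ∀ a ∈ univ \ {i, j}, (sendMoveCount k i j a i : ℤ) = B := fun a ha => by
    rw [sendMoveCount_target j ((mU a).1 ha).1, sendB a ha]
  have sourceB : ∀ a ∈ univ \ {i, j}, (sendMoveCount k i j a a : ℤ) = B := fun a ha => by
    rw [sendMoveCount_source j ((mU a).1 ha).1, sendB a ha]
  have hsymm : ∀ a ∈ univ \ {i, j}, ∀ b ∈ univ \ {i, j},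
      (sendMoveCount k i j a b : ℤ) = sendMoveCount k i j b a := by
    intro a ha b hb
    rw [mU] at ha hb
    rw [sendMoveCount_conj (π := swap a b)
      (swap_apply_of_ne_of_ne ha.1.symm hb.1.symm)
      (swap_apply_of_ne_of_ne ha.2.symm hb.2.symm) a b, swap_apply_left, swap_apply_right]
  have eF : ((n : ℤ) - 1) * F = k * (permsFixing k j).card := card_permsFixing_filter_fixed hne
  have eB : ((n : ℤ) - 2) * B = (permsFixing k j).card - F := by
    have h := sum_card_permsFixing_send (k := k) i j
    rw [sum_univ_eq_add_add hne, sum_congr rfl sendB, permsFixing_send_self hne, sum_const,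
      nsmul_eq_mul, cU, card_empty] at h
    push_cast at h
    linarith
  have eA : ((n : ℤ) - 2) * A = F * ((n : ℤ) - k - 1) := by
    have h := sum_sendMoveCount (k := k) i j i
    rw [sum_univ_eq_add_add hne, sum_congr rfl sendA, sendMoveCount_self,
      sendMoveCount_fixed_right, sum_const, nsmul_eq_mul, cU] at h
    push_cast at h
    linarith
  have eC : 2 * ∑ b ∈ univ \ {i, j}, ∑ a ∈ univ \ {i, j},
      (if a < b then (sendMoveCount k i j a b : ℤ) else 0) =
      ((n : ℤ) - 2) * (B * ((n : ℤ) - k - 3)) := by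
    rw [two_mul_sum_lt_eq _ (fun a b => (sendMoveCount k i j a b : ℤ)) hsymm, ← cU,
      ← nsmul_eq_mul, ← sum_const]
    refine sum_congr rfl fun a ha => ?_
    have h := sum_sendMoveCount (k := k) i j a
    rw [sum_univ_eq_add_add hne, targetB a ha, sendB a ha, sendMoveCount_fixed_right] at h
    push_cast at h
    rw [sourceB a ha]
    linarith
  have eN := sum_sum_swap_lt_eq hij (fun a b => (sendMoveCount k i j a b : ℤ)) A B
    (fun b => by simp [sendMoveCount_fixed_source hne]) (fun a => by simp [sendMoveCount_fixed_right])
    (by simp [sendMoveCount_self]) sendA targetB sourceB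
  rw [card_filter_eq_sum_sendMoveCount]
  push_cast
  rw [eN]
  linear_combination ((n : ℤ) - 1) * (n - 2) * eC + 2 * ((n : ℤ) - 1) * (n - i - 2) * eA
    + (2 * ((n : ℤ) - 1) * (i + (n - 1 - j)) + ((n : ℤ) - 1) * (n - 2) * (n - k - 3)) * eB
    + (2 * ((n : ℤ) - i - 2) * (n - k - 1) - 2 * (i + (n - 1 - j))
      - ((n : ℤ) - 2) * (n - k - 3)) * eF

end

/-- The number of permutations of `{1,…,n}` with exactly `k` fixed points in which `j`
lies in a cycle of length at least 3 and `i` precedes `j` satisfies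
`2(n-1)(n-2) · # = d_{n-1,k} · (n-k-1) · (2k(n-i-1) + 2(i-1+n-j) + (n-2)(n-3-k))`. -/
theorem stmt18 (n k i j : ℕ) (hn : 3 ≤ n) (hk : k ≤ n)
    (hi : 1 ≤ i) (hij : i < j) (hj : j ≤ n) :
    2 * ((n : ℤ) - 1) * ((n : ℤ) - 2) * (((permsWithFixed n k).filter
        (fun σ => σ (⟨j - 1, by omega⟩ : Fin n) ≠ (⟨j - 1, by omega⟩ : Fin n) ∧
          σ (σ (⟨j - 1, by omega⟩ : Fin n)) ≠ (⟨j - 1, by omega⟩ : Fin n) ∧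
          σ⁻¹ (⟨i - 1, by omega⟩ : Fin n) < σ⁻¹ (⟨j - 1, by omega⟩ : Fin n))).card : ℤ) =
      (numPermsWithFixed (n - 1) k : ℤ) * ((n : ℤ) - (k : ℤ) - 1) *
        (2 * (k : ℤ) * ((n : ℤ) - (i : ℤ) - 1) +
          2 * ((i : ℤ) - 1 + (n : ℤ) - (j : ℤ)) +
          ((n : ℤ) - 2) * ((n : ℤ) - 3 - (k : ℤ))) := by
  have h := card_longCycle_precedes (k := k) hn
    (show (⟨i - 1, by omega⟩ : Fin n) < ⟨j - 1, by omega⟩ from Fin.mk_lt_mk.2 (by omega))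
  obtain ⟨m, rfl⟩ : ∃ m, n = m + 1 := ⟨n - 1, by omega⟩
  rw [card_permsFixing] at h
  rw [h, Nat.add_sub_cancel]
  dsimp only
  rw [Nat.cast_sub hi, Nat.cast_sub (by omega : 1 ≤ j)]
  push_cast
  ring
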